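/- Let α ∈ (0,1), K > 0, t ∈ (0, 1], β ∈ (0, α), and let f, g : ℝ → ℝ be 2π-periodic functions, each α-Hölder with constant K, such that sup_{ξ ∈ ℝ} |f(ξ) − g(ξ)| ≤ K·t^α. Then there exists a constant C depending only on α such that for every ξ ∈ ℝ, |Hf(ξ) − Hg(ξ)| ≤ C·(α − β)^{−1}·K·t^β. -/

import Mathlib

open MeasureTheory

/-- `IsHilbertTransformAt f ξ L` says that the principal value
`(1/π) · lim_{ε→0⁺} ∫_{ε ≤ |θ| ≤ π} cot(θ/2)·f(ξ - θ) dθ` exists and equals `L`;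
i.e. `L` is the value of the (circle) Hilbert transform of `f` at `ξ`. -/
def IsHilbertTransformAt (f : ℝ → ℝ) (ξ L : ℝ) : Prop :=
  Filter.Tendsto
    (fun ε : ℝ => (1 / Real.pi) *
      ∫ θ in {θ : ℝ | ε ≤ |θ| ∧ |θ| ≤ Real.pi}, Real.cot (θ/2) * f (ξ - θ))
    (nhdsWithin 0 (Set.Ioi 0)) (nhds L)

lemma abs_cot_half_le {θ : ℝ} (hθ : |θ| ≤ Real.pi) : |Real.cot (θ / 2)| ≤ 2 / |θ| := by
  have key : ∀ x : ℝ, 0 < x → x ≤ Real.pi / 2 → |Real.cot x| ≤ 1 / x := by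
    intro x hx hx'
    have hs : 0 < Real.sin x := Real.sin_pos_of_pos_of_lt_pi hx (by linarith [Real.pi_pos])
    have hc : 0 ≤ Real.cos x := Real.cos_nonneg_of_mem_Icc ⟨by linarith, hx'⟩
    rw [Real.cot_eq_cos_div_sin, abs_of_nonneg (by positivity), div_le_div_iff₀ hs hx]
    rcases hx'.lt_or_eq with h | rfl
    · have hc' : 0 < Real.cos x := Real.cos_pos_of_mem_Ioo ⟨by linarith, h⟩
      have ht := Real.le_tan hx.le h
      rw [Real.tan_eq_sin_div_cos, le_div_iff₀ hc'] at ht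
      linarith
    · simp
  rcases lt_trichotomy θ 0 with h | rfl | h
  · have := key (-(θ / 2)) (by linarith) (by rw [abs_of_neg h] at hθ; linarith)
    rw [Real.cot_eq_cos_div_sin, Real.cos_neg, Real.sin_neg, div_neg, abs_neg,
      ← Real.cot_eq_cos_div_sin] at this
    refine this.trans_eq ?_
    rw [abs_of_neg h]
    field_simp
  · simp [Real.cot_eq_cos_div_sin]
  · have := key (θ / 2) (by linarith) (by rw [abs_of_pos h] at hθ; linarith)
    refine this.trans_eq ?_
    rw [abs_of_pos h]
    field_simp

lemma measurable_cot_half : Measurable fun θ : ℝ => Real.cot (θ / 2) := by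
  simp only [Real.cot_eq_cos_div_sin]
  fun_prop

lemma measurableSet_abs_annulus (a b : ℝ) : MeasurableSet {θ : ℝ | a ≤ |θ| ∧ |θ| ≤ b} :=
  (measurableSet_le measurable_const continuous_abs.measurable).inter
    (measurableSet_le continuous_abs.measurable measurable_const)

lemma setOf_abs_le_eq_Icc (b : ℝ) : {θ : ℝ | |θ| ≤ b} = Set.Icc (-b) b := by
  ext θ
  exact abs_le (a := θ)

lemma intervalIntegrable_abs_rpow {r : ℝ} (hr : -1 < r) (a b : ℝ) :
    IntervalIntegrable (fun θ : ℝ => |θ| ^ r) volume a b := by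
  refine intervalIntegrable_of_even (fun x => by rw [abs_neg]) fun x hx => ?_
  refine (intervalIntegral.intervalIntegrable_rpow' hr).congr_ae ?_
  filter_upwards [ae_restrict_mem measurableSet_uIoc] with y hy
  rw [Set.uIoc_of_le hx.le] at hy
  rw [abs_of_pos hy.1]

lemma integrableOn_abs_rpow {r b : ℝ} (hr : -1 < r) (hb : 0 ≤ b) :
    IntegrableOn (fun θ : ℝ => |θ| ^ r) {θ : ℝ | |θ| ≤ b} := by
  rw [setOf_abs_le_eq_Icc, ← intervalIntegrable_iff_integrableOn_Icc_of_le (by linarith)]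
  exact intervalIntegrable_abs_rpow hr _ _

lemma integral_abs_rpow {r b : ℝ} (hr : -1 < r) (hb : 0 ≤ b) :
    ∫ θ in {θ : ℝ | |θ| ≤ b}, |θ| ^ r = 2 * (b ^ (r + 1) / (r + 1)) := by
  have hpos : ∫ θ in (0 : ℝ)..b, |θ| ^ r = b ^ (r + 1) / (r + 1) := by
    rw [intervalIntegral.integral_congr (g := fun θ : ℝ => θ ^ r), integral_rpow (Or.inl hr),
      Real.zero_rpow (by linarith), sub_zero]
    intro θ hθ
    rw [Set.uIcc_of_le hb] at hθ
    simp only [abs_of_nonneg hθ.1]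
  have hneg : ∫ θ in (-b)..0, |θ| ^ r = ∫ θ in (0 : ℝ)..b, |θ| ^ r := by
    have := intervalIntegral.integral_comp_neg (a := 0) (b := b) fun θ : ℝ => |θ| ^ r
    simpa using this.symm
  rw [setOf_abs_le_eq_Icc, integral_Icc_eq_integral_Ioc,
    ← intervalIntegral.integral_of_le (by linarith),
    ← intervalIntegral.integral_add_adjacent_intervals (intervalIntegrable_abs_rpow hr _ 0)
      (intervalIntegrable_abs_rpow hr 0 _), hneg, hpos, two_mul]

lemma integral_cot_half_annulus (ε : ℝ) :
    ∫ θ in {θ : ℝ | ε ≤ |θ| ∧ |θ| ≤ Real.pi}, Real.cot (θ / 2) = 0 := by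
  rw [← integral_indicator (measurableSet_abs_annulus _ _)]
  have h := integral_neg_eq_self
    ({θ : ℝ | ε ≤ |θ| ∧ |θ| ≤ Real.pi}.indicator fun θ => Real.cot (θ / 2)) volume
  have hodd : ∀ θ : ℝ, {θ : ℝ | ε ≤ |θ| ∧ |θ| ≤ Real.pi}.indicator
      (fun θ => Real.cot (θ / 2)) (-θ) = -{θ : ℝ | ε ≤ |θ| ∧ |θ| ≤ Real.pi}.indicator
      (fun θ => Real.cot (θ / 2)) θ := by
    intro θ
    by_cases hθ : ε ≤ |θ| ∧ |θ| ≤ Real.pi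
    · rw [Set.indicator_of_mem (by simpa using hθ), Set.indicator_of_mem (by simpa using hθ)]
      simp only [Real.cot_eq_cos_div_sin, neg_div, Real.cos_neg, Real.sin_neg, div_neg]
    · rw [Set.indicator_of_notMem (by simpa using hθ), Set.indicator_of_notMem (by simpa using hθ),
        neg_zero]
  simp only [hodd, integral_neg] at h
  linarith

lemma norm_cot_half_mul_le {f : ℝ → ℝ} {ξ M γ : ℝ}
    (hf : ∀ θ : ℝ, |f (ξ - θ) - f ξ| ≤ M * |θ| ^ γ) {θ : ℝ} (hθ : |θ| ≤ Real.pi) :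
    ‖Real.cot (θ / 2) * (f (ξ - θ) - f ξ)‖ ≤ 2 * M * |θ| ^ (γ - 1) := by
  have hM : 0 ≤ M := by simpa using (abs_nonneg _).trans (hf 1)
  rw [Real.norm_eq_abs, abs_mul]
  rcases eq_or_ne θ 0 with rfl | h0
  · simp only [sub_zero, sub_self, abs_zero, mul_zero]
    positivity
  · calc |Real.cot (θ / 2)| * |f (ξ - θ) - f ξ| ≤ 2 / |θ| * (M * |θ| ^ γ) := by
          gcongr
          · exact abs_cot_half_le hθ
          · exact hf θ
      _ = 2 * M * |θ| ^ (γ - 1) := by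
          rw [Real.rpow_sub_one (abs_ne_zero.mpr h0)]
          ring

lemma integrableOn_cot_half_mul {f : ℝ → ℝ} {ξ M γ : ℝ} (hγ : 0 < γ) (hfm : Measurable f)
    (hf : ∀ θ : ℝ, |f (ξ - θ) - f ξ| ≤ M * |θ| ^ γ) :
    IntegrableOn (fun θ => Real.cot (θ / 2) * (f (ξ - θ) - f ξ)) {θ : ℝ | |θ| ≤ Real.pi} := by
  refine Integrable.mono' ((integrableOn_abs_rpow (r := γ - 1) (by linarith)
    Real.pi_pos.le).const_mul (2 * M)) ?_ ?_
  · exact (measurable_cot_half.mul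
      ((hfm.comp (measurable_const.sub measurable_id)).sub_const _)).aestronglyMeasurable
  · filter_upwards [ae_restrict_mem (measurableSet_le continuous_abs.measurable measurable_const)]
      with θ hθ using norm_cot_half_mul_le hf hθ

lemma isHilbertTransformAt_of_holder {f : ℝ → ℝ} {ξ M γ : ℝ} (hγ : 0 < γ) (hfm : Measurable f)
    (hf : ∀ θ : ℝ, |f (ξ - θ) - f ξ| ≤ M * |θ| ^ γ) :
    IsHilbertTransformAt f ξ ((1 / Real.pi) *
      ∫ θ in {θ : ℝ | |θ| ≤ Real.pi}, Real.cot (θ / 2) * (f (ξ - θ) - f ξ)) := by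
  have hT : MeasurableSet {θ : ℝ | |θ| ≤ Real.pi} :=
    measurableSet_le continuous_abs.measurable measurable_const
  have hF := integrableOn_cot_half_mul hγ hfm hf
  refine Filter.Tendsto.const_mul _ ?_
  have hlim : Filter.Tendsto (fun ε : ℝ => ∫ θ in {θ : ℝ | ε ≤ |θ| ∧ |θ| ≤ Real.pi},
      Real.cot (θ / 2) * (f (ξ - θ) - f ξ)) (nhdsWithin 0 (Set.Ioi 0))
      (nhds (∫ θ in {θ : ℝ | |θ| ≤ Real.pi}, Real.cot (θ / 2) * (f (ξ - θ) - f ξ))) := by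
    simp only [← integral_indicator (measurableSet_abs_annulus _ _), ← integral_indicator hT]
    rw [← integrable_indicator_iff hT] at hF
    refine tendsto_integral_filter_of_dominated_convergence _ ?_ ?_ hF.norm ?_
    · refine Filter.Eventually.of_forall fun ε => ?_
      exact ((measurable_cot_half.mul ((hfm.comp (measurable_const.sub measurable_id)).sub_const
        _)).indicator (measurableSet_abs_annulus _ _)).aestronglyMeasurable
    · exact Filter.Eventually.of_forall fun ε => Filter.Eventually.of_forall fun θ =>
        norm_indicator_le_of_subset (fun x hx => hx.2) _ _
    · refine Filter.Eventually.of_forall fun θ => ?_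
      rcases eq_or_ne θ 0 with rfl | h0
      · simp [Set.indicator_apply]
      · refine tendsto_const_nhds.congr' ?_
        have : ∀ᶠ ε : ℝ in nhdsWithin 0 (Set.Ioi 0), ε ≤ |θ| :=
          nhdsWithin_le_nhds (Iic_mem_nhds (abs_pos.mpr h0))
        filter_upwards [this] with ε hε
        simp [Set.indicator_apply, hε]
  refine hlim.congr' ?_
  filter_upwards [self_mem_nhdsWithin] with ε hε
  have hε : 0 < ε := hε
  have hsub : {θ : ℝ | ε ≤ |θ| ∧ |θ| ≤ Real.pi} ⊆ {θ : ℝ | |θ| ≤ Real.pi} := fun x hx => hx.2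
  have hcot : IntegrableOn (fun θ : ℝ => Real.cot (θ / 2))
      {θ : ℝ | ε ≤ |θ| ∧ |θ| ≤ Real.pi} := by
    refine Measure.integrableOn_of_bounded (M := 2 / ε) ?_
      measurable_cot_half.aestronglyMeasurable ?_
    · refine measure_ne_top_of_subset hsub ?_
      rw [setOf_abs_le_eq_Icc]
      exact measure_Icc_lt_top.ne
    · filter_upwards [ae_restrict_mem (measurableSet_abs_annulus _ _)] with θ hθ
      refine (abs_cot_half_le hθ.2).trans ?_
      gcongr
      exact hθ.1
  calc ∫ θ in {θ : ℝ | ε ≤ |θ| ∧ |θ| ≤ Real.pi}, Real.cot (θ / 2) * (f (ξ - θ) - f ξ)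
      = (∫ θ in {θ : ℝ | ε ≤ |θ| ∧ |θ| ≤ Real.pi}, Real.cot (θ / 2) * (f (ξ - θ) - f ξ))
        + ∫ θ in {θ : ℝ | ε ≤ |θ| ∧ |θ| ≤ Real.pi}, Real.cot (θ / 2) * f ξ := by
        rw [integral_mul_const, integral_cot_half_annulus, zero_mul, add_zero]
    _ = ∫ θ in {θ : ℝ | ε ≤ |θ| ∧ |θ| ≤ Real.pi}, Real.cot (θ / 2) * f (ξ - θ) := by
        rw [← integral_add (integrableOn_cot_half_mul hγ hfm hf |>.mono_set hsub)
          (hcot.mul_const _)]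
        congr 1 with θ
        ring

lemma abs_integral_cot_half_mul_le {f : ℝ → ℝ} {ξ M γ : ℝ} (hγ : 0 < γ)
    (hf : ∀ θ : ℝ, |f (ξ - θ) - f ξ| ≤ M * |θ| ^ γ) :
    |∫ θ in {θ : ℝ | |θ| ≤ Real.pi}, Real.cot (θ / 2) * (f (ξ - θ) - f ξ)|
      ≤ 4 * M * (Real.pi ^ γ / γ) := by
  have hint := (integrableOn_abs_rpow (r := γ - 1) (by linarith) Real.pi_pos.le).const_mul (2 * M)
  rw [← Real.norm_eq_abs]
  refine (norm_integral_le_of_norm_le hint ?_).trans_eq ?_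
  · filter_upwards [ae_restrict_mem (measurableSet_le continuous_abs.measurable measurable_const)]
      with θ hθ using norm_cot_half_mul_le hf hθ
  · rw [integral_const_mul, integral_abs_rpow (by linarith) Real.pi_pos.le, sub_add_cancel]
    ring

lemma continuous_of_abs_sub_le_rpow {f : ℝ → ℝ} {K α : ℝ} (hα : 0 < α)
    (hf : ∀ s u : ℝ, |f s - f u| ≤ K * |s - u| ^ α) : Continuous f := by
  refine continuous_iff_continuousAt.mpr fun u => ?_
  rw [ContinuousAt, tendsto_iff_dist_tendsto_zero]
  refine squeeze_zero (fun _ => dist_nonneg) (fun s => hf s u) ?_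
  have : Continuous fun s : ℝ => K * |s - u| ^ α :=
    continuous_const.mul ((continuous_abs.comp (continuous_id.sub continuous_const)).rpow_const
      fun _ => Or.inr hα.le)
  simpa [Real.zero_rpow hα.ne'] using this.tendsto u

lemma min_rpow_le_rpow_mul_rpow {x t α β : ℝ} (hx : 0 ≤ x) (ht : 0 < t) (hβ : 0 ≤ β)
    (hβα : β < α) : min (x ^ α) (t ^ α) ≤ x ^ (α - β) * t ^ β := by
  rcases le_total x t with h | h
  · refine (min_le_left _ _).trans ?_
    rcases hx.eq_or_lt with rfl | hx
    · rw [Real.zero_rpow (by linarith)]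
      positivity
    · calc x ^ α = x ^ (α - β) * x ^ β := by rw [← Real.rpow_add hx, sub_add_cancel]
        _ ≤ _ := by gcongr
  · refine (min_le_right _ _).trans ?_
    calc t ^ α = t ^ (α - β) * t ^ β := by rw [← Real.rpow_add ht, sub_add_cancel]
      _ ≤ _ := by
        gcongr

/-- Two-function form of the second estimate of the paper's Lemma 6.2: lowering the
Hölder exponent from `α` to `β < α` makes the Hilbert transform bounded in the parameter
direction, at the cost of a factor `(α - β)⁻¹`: for `2π`-periodic `α`-Hölder functions
`f`, `g` with constant `K` and `sup |f - g| ≤ K·t^α`, `t ∈ (0,1]`, one has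
`|Hf(ξ) - Hg(ξ)| ≤ C·(α - β)⁻¹·K·t^β` with `C` depending only on `α`. -/
theorem stmt_11 (α : ℝ) (hα : α ∈ Set.Ioo (0:ℝ) 1) :
    ∃ C : ℝ, 0 < C ∧
      ∀ K t β : ℝ, 0 < K → t ∈ Set.Ioc (0:ℝ) 1 → β ∈ Set.Ioo (0:ℝ) α →
      ∀ f g : ℝ → ℝ,
        Function.Periodic f (2*Real.pi) → Function.Periodic g (2*Real.pi) →
        (∀ s u : ℝ, |f s - f u| ≤ K * |s - u| ^ α) →
        (∀ s u : ℝ, |g s - g u| ≤ K * |s - u| ^ α) →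
        (∀ ξ : ℝ, |f ξ - g ξ| ≤ K * t ^ α) →
        ∀ ξ : ℝ, ∃ Lf Lg : ℝ,
          IsHilbertTransformAt f ξ Lf ∧ IsHilbertTransformAt g ξ Lg ∧
          |Lf - Lg| ≤ C * (α - β)⁻¹ * K * t ^ β := by
  obtain ⟨hα0, hα1⟩ := hα
  refine ⟨8, by norm_num, ?_⟩
  intro K t β hK ht hβ f g _ _ hf hg hfg ξ
  have ht0 : 0 < t := ht.1
  have hγ : 0 < α - β := sub_pos.mpr hβ.2
  have hfm := (continuous_of_abs_sub_le_rpow hα0 hf).measurable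
  have hgm := (continuous_of_abs_sub_le_rpow hα0 hg).measurable
  have hfξ : ∀ θ : ℝ, |f (ξ - θ) - f ξ| ≤ K * |θ| ^ α := fun θ => by simpa using hf (ξ - θ) ξ
  have hgξ : ∀ θ : ℝ, |g (ξ - θ) - g ξ| ≤ K * |θ| ^ α := fun θ => by simpa using hg (ξ - θ) ξ
  refine ⟨_, _, isHilbertTransformAt_of_holder hα0 hfm hfξ,
    isHilbertTransformAt_of_holder hα0 hgm hgξ, ?_⟩
  have hdiff : ∀ θ : ℝ,
      |(f - g) (ξ - θ) - (f - g) ξ| ≤ (2 * K * t ^ β) * |θ| ^ (α - β) := by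
    intro θ
    have hmin : |(f - g) (ξ - θ) - (f - g) ξ| ≤ 2 * K * min (|θ| ^ α) (t ^ α) := by
      rw [mul_min_of_nonneg _ _ (by positivity)]
      refine le_min ?_ ?_
      · calc |(f - g) (ξ - θ) - (f - g) ξ|
            = |(f (ξ - θ) - f ξ) - (g (ξ - θ) - g ξ)| := by
              simp only [Pi.sub_apply]
              ring_nf
          _ ≤ _ := (abs_sub _ _).trans (by linarith [hfξ θ, hgξ θ])
      · exact (abs_sub _ _).trans (by
          simp only [Pi.sub_apply]
          linarith [hfg (ξ - θ), hfg ξ])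
    calc _ ≤ _ := hmin
      _ ≤ 2 * K * (|θ| ^ (α - β) * t ^ β) := by
        gcongr
        exact min_rpow_le_rpow_mul_rpow (abs_nonneg θ) ht0 hβ.1.le hβ.2
      _ = _ := by ring
  have hbound := abs_integral_cot_half_mul_le hγ hdiff
  have hπ : Real.pi ^ (α - β) ≤ Real.pi := by
    calc Real.pi ^ (α - β) ≤ Real.pi ^ (1 : ℝ) :=
          Real.rpow_le_rpow_of_exponent_le (by linarith [Real.pi_gt_three]) (by linarith [hβ.1])
      _ = Real.pi := Real.rpow_one _
  rw [← mul_sub, ← integral_sub (integrableOn_cot_half_mul hα0 hfm hfξ)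
    (integrableOn_cot_half_mul hα0 hgm hgξ), abs_mul, abs_of_pos (by positivity)]
  have heq : ∀ θ : ℝ, Real.cot (θ / 2) * (f (ξ - θ) - f ξ) - Real.cot (θ / 2) * (g (ξ - θ) - g ξ)
      = Real.cot (θ / 2) * ((f - g) (ξ - θ) - (f - g) ξ) := fun θ => by
    simp only [Pi.sub_apply]
    ring
  simp only [heq]
  calc _ ≤ 1 / Real.pi * (4 * (2 * K * t ^ β) * (Real.pi / (α - β))) := by
        refine mul_le_mul_of_nonneg_left (hbound.trans ?_) (by positivity)
        gcongr
    _ = 8 * (α - β)⁻¹ * K * t ^ β := by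
        field_simp
        ring
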